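/- Let d ≥ 1, let X ⊆ ℝ^d be nonempty, closed and convex, let f : ℝ^d → ℝ be differentiable, and let h : ℝ^d → ℝ be differentiable with Bregman divergence D_h(u,v) := h(u) − h(v) − ⟨∇h(v), u − v⟩ satisfying D_h(u,v) ≥ (1/2)‖u − v‖₁² for all u, v ∈ ℝ^d. Suppose ρ > 0 is such that f + ρh is convex, and let λ ∈ (0, 1/ρ). Fix x ∈ X and let x̂ ∈ X be a minimizer over X of y ↦ f(y) + (1/λ) D_h(y, x). Then every v ∈ ℝ^d satisfying ⟨v − ∇f(x), y − x⟩ ≤ 0 for all y ∈ X obeys ‖v‖∞ ≥ (1 − λρ) · (1/λ) · √(D_h(x, x̂) + D_h(x̂, x)). Consequently the residual r(x) := inf{‖v‖∞ : ⟨v − ∇f(x), y − x⟩ ≤ 0 for all y ∈ X} satisfies r(x) ≥ (1 − λρ) r₂(x), where r₂(x) := (1/λ)√(D_h(x, x̂) + D_h(x̂, x)). -/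

import Mathlib

open MeasureTheory ProbabilityTheory Finset
open scoped BigOperators

local notation "⟪" x ", " y "⟫" => @inner ℝ _ _ x y

noncomputable def norm1 {d : ℕ} (x : EuclideanSpace ℝ (Fin d)) : ℝ := ∑ i, |x i|

noncomputable def normInf {d : ℕ} (x : EuclideanSpace ℝ (Fin d)) : ℝ := ⨆ i, |x i|

/-- Bregman divergence `D_h(u,v) = h(u) - h(v) - ⟨∇h(v), u - v⟩`. -/
noncomputable def bregman {d : ℕ} (h : EuclideanSpace ℝ (Fin d) → ℝ)
    (u v : EuclideanSpace ℝ (Fin d)) : ℝ :=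
  h u - h v - ⟪gradient h v, u - v⟫

/-- A linear lower bound of `G` along the initial piece of a ray bounds the derivative there. -/
theorem le_inner_gradient_of_forall_le {d : ℕ} {G : EuclideanSpace ℝ (Fin d) → ℝ}
    {a w g : EuclideanSpace ℝ (Fin d)} {c : ℝ} (hG : HasGradientAt G g a)
    (hc : ∀ t : ℝ, 0 < t → t ≤ 1 → G a + t * c ≤ G (a + t • w)) : c ≤ ⟪g, w⟫ := by
  have h1 := (hG.hasFDerivAt.hasLineDerivAt w).tendsto_slope_zero_right
  rw [InnerProductSpace.toDual_apply_apply] at h1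
  refine ge_of_tendsto h1 ?_
  filter_upwards [Ioc_mem_nhdsGT (zero_lt_one' ℝ)] with t ht
  have h2 := hc t ht.1 ht.2
  rw [smul_eq_mul, inv_mul_eq_div, le_div_iff₀ ht.1]
  linarith

theorem ConvexOn.inner_gradient_le_sub {d : ℕ} {F : EuclideanSpace ℝ (Fin d) → ℝ}
    (hF : ConvexOn ℝ Set.univ F) {a g : EuclideanSpace ℝ (Fin d)} (hg : HasGradientAt F g a)
    (y : EuclideanSpace ℝ (Fin d)) : ⟪g, y - a⟫ ≤ F y - F a := by
  have hneg : HasGradientAt (fun z => -F z) (-g) a := by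
    rw [hasGradientAt_iff_hasFDerivAt, map_neg]
    exact hg.hasFDerivAt.neg
  have h1 : -(F y - F a) ≤ ⟪-g, y - a⟫ := by
    refine le_inner_gradient_of_forall_le hneg fun t ht0 ht1 => ?_
    have h2 := hF.2 (Set.mem_univ a) (Set.mem_univ y) (sub_nonneg.2 ht1) ht0.le (by ring)
    have h3 : (1 - t) • a + t • y = a + t • (y - a) := by module
    rw [h3, smul_eq_mul, smul_eq_mul] at h2
    linarith
  rw [inner_neg_left] at h1
  linarith

theorem normInf_nonneg {d : ℕ} (v : EuclideanSpace ℝ (Fin d)) : 0 ≤ normInf v :=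
  Real.iSup_nonneg fun _ => abs_nonneg _

theorem norm1_sub_comm {d : ℕ} (u v : EuclideanSpace ℝ (Fin d)) :
    norm1 (u - v) = norm1 (v - u) := by
  simp only [norm1, PiLp.sub_apply, abs_sub_comm]

theorem inner_le_normInf_mul_norm1 {d : ℕ} (v w : EuclideanSpace ℝ (Fin d)) :
    ⟪v, w⟫ ≤ normInf v * norm1 w := by
  rw [PiLp.inner_apply, norm1, Finset.mul_sum]
  refine Finset.sum_le_sum fun i _ => ?_
  calc ⟪v i, w i⟫ = v i * w i := by simp [mul_comm]
    _ ≤ |v i| * |w i| := by rw [← abs_mul]; exact le_abs_self _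
    _ ≤ normInf v * |w i| := by
        gcongr
        exact le_ciSup (f := fun i => |v i|) (Set.finite_range _).bddAbove i

theorem bregman_add_bregman {d : ℕ} (h : EuclideanSpace ℝ (Fin d) → ℝ)
    (u v : EuclideanSpace ℝ (Fin d)) :
    bregman h u v + bregman h v u = ⟪gradient h u - gradient h v, u - v⟫ := by
  simp only [bregman, inner_sub_left, inner_sub_right]
  ring

theorem stmt_0 {d : ℕ} (hd : 1 ≤ d)
    (X : Set (EuclideanSpace ℝ (Fin d)))
    (hXne : X.Nonempty) (hXcl : IsClosed X) (hXcv : Convex ℝ X)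
    (f h : EuclideanSpace ℝ (Fin d) → ℝ)
    (hf : Differentiable ℝ f) (hh : Differentiable ℝ h)
    (hstrong : ∀ u v, bregman h u v ≥ (1 / 2) * (norm1 (u - v)) ^ 2)
    (ρ : ℝ) (hρ : 0 < ρ)
    (hconv : ConvexOn ℝ Set.univ (fun z => f z + ρ * h z))
    (lam : ℝ) (hlam : lam ∈ Set.Ioo (0 : ℝ) (1 / ρ))
    (x : EuclideanSpace ℝ (Fin d)) (hx : x ∈ X)
    (xhat : EuclideanSpace ℝ (Fin d)) (hxhat : xhat ∈ X)
    (hmin : ∀ y ∈ X, f xhat + (1 / lam) * bregman h xhat x ≤ f y + (1 / lam) * bregman h y x) :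
    (∀ v : EuclideanSpace ℝ (Fin d),
        (∀ y ∈ X, ⟪v - gradient f x, y - x⟫ ≤ 0) →
        normInf v ≥ (1 - lam * ρ) * ((1 / lam) * Real.sqrt (bregman h x xhat + bregman h xhat x)))
    ∧ sInf {c : ℝ | ∃ v : EuclideanSpace ℝ (Fin d),
          (∀ y ∈ X, ⟪v - gradient f x, y - x⟫ ≤ 0) ∧ c = normInf v}
        ≥ (1 - lam * ρ) * ((1 / lam) * Real.sqrt (bregman h x xhat + bregman h xhat x)) := by
  obtain ⟨hl0, hl1⟩ := hlam
  have hlr : lam * ρ < 1 := by rwa [lt_div_iff₀ hρ] at hl1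
  have key : ∀ v : EuclideanSpace ℝ (Fin d),
      (∀ y ∈ X, ⟪v - gradient f x, y - x⟫ ≤ 0) →
      normInf v ≥
        (1 - lam * ρ) * ((1 / lam) * Real.sqrt (bregman h x xhat + bregman h xhat x)) := by
    intro v hv
    have hgrad : ∀ (z : EuclideanSpace ℝ (Fin d)) (c : ℝ),
        HasGradientAt (fun y => f y + c * h y) (gradient f z + c • gradient h z) z := by
      intro z c
      rw [hasGradientAt_iff_hasFDerivAt, map_add, map_smulₛₗ]
      exact (hf z).hasGradientAt.hasFDerivAt.add ((hh z).hasGradientAt.hasFDerivAt.const_mul c)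
    have hopt : (1 / lam) * ⟪gradient h x, x - xhat⟫
        ≤ ⟪gradient f xhat + (1 / lam) • gradient h xhat, x - xhat⟫ := by
      refine le_inner_gradient_of_forall_le (hgrad xhat (1 / lam)) fun t ht0 ht1 => ?_
      have hmem : xhat + t • (x - xhat) ∈ X :=
        hXcv.add_smul_sub_mem hxhat hx ⟨ht0.le, ht1⟩
      have h1 := hmin _ hmem
      have h2 : xhat + t • (x - xhat) - x = (xhat - x) + t • (x - xhat) := by abel
      simp only [bregman] at h1
      rw [h2, inner_add_right, real_inner_smul_right] at h1
      linarith
    have hmono1 := hconv.inner_gradient_le_sub (hgrad x ρ) xhat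
    have hmono2 := hconv.inner_gradient_le_sub (hgrad xhat ρ) x
    have hvx := hv xhat hxhat
    have hsum := bregman_add_bregman h x xhat
    have hS1 : norm1 (x - xhat) ^ 2 ≤ bregman h x xhat + bregman h xhat x := by
      have h1 := hstrong x xhat
      have h2 := hstrong xhat x
      rw [norm1_sub_comm xhat x] at h2
      linarith
    set S := bregman h x xhat + bregman h xhat x
    have hS0 : 0 ≤ S := (sq_nonneg _).trans hS1
    have hbound : (1 / lam - ρ) * S ≤ ⟪v, x - xhat⟫ := by
      rw [← neg_sub x xhat, inner_neg_right] at hmono1 hvx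
      simp only [inner_add_left, inner_sub_left, real_inner_smul_left] at *
      rw [hsum]
      linarith
    have hn1 : norm1 (x - xhat) ≤ √S := Real.le_sqrt_of_sq_le hS1
    have hmul : (1 / lam - ρ) * S ≤ normInf v * √S :=
      hbound.trans <| (inner_le_normInf_mul_norm1 v _).trans <|
        mul_le_mul_of_nonneg_left hn1 (normInf_nonneg v)
    have hcoef : (1 - lam * ρ) * ((1 / lam) * √S) = (1 / lam - ρ) * √S := by
      field_simp
    rw [ge_iff_le, hcoef]
    rcases (Real.sqrt_nonneg S).eq_or_lt with h0 | hpos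
    · rw [← h0, mul_zero]
      exact normInf_nonneg v
    · refine le_of_mul_le_mul_right ?_ hpos
      rwa [mul_assoc, Real.mul_self_sqrt hS0]
  refine ⟨key, le_csInf ⟨_, gradient f x, fun y _ => by simp, rfl⟩ ?_⟩
  rintro c ⟨v, hv, rfl⟩
  exact key v hv
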